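/- For every t ≥ 0 the following inequality holds: 1 + ∫₀ᵗ |s − max(0, t − √(log 2))|·e^{s·√(log 2)} ds ≤ e^{t·√(log 2)}. (That is, the pair v₂(t) = e^{t√(log 2)}, r₂(t) = max{0, t − √(log 2)} forms a supersolution of the integral inequality v(t) ≥ 1 + ∫₀ᵗ |s − r(t)|·v(s) ds.) -/

import Mathlib

/-- The fundamental theorem of calculus for `s ↦ (s - r) * exp (s * a)`. -/
theorem integral_sub_mul_exp_mul {a : ℝ} (ha : a ≠ 0) (r x y : ℝ) :
    ∫ s in x..y, (s - r) * Real.exp (s * a) =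
      ((y - r) / a - 1 / a ^ 2) * Real.exp (y * a)
        - ((x - r) / a - 1 / a ^ 2) * Real.exp (x * a) := by
  refine intervalIntegral.integral_eq_sub_of_hasDerivAt
    (f := fun s => ((s - r) / a - 1 / a ^ 2) * Real.exp (s * a)) (fun s _ => ?_)
    (Continuous.intervalIntegrable (by fun_prop) _ _)
  have h := ((((hasDerivAt_id s).sub_const r).div_const a).sub_const (1 / a ^ 2)).mul
    ((hasDerivAt_id s).mul_const a).exp
  refine h.congr_deriv ?_
  simp only [id]
  field_simp
  ring

/-- The integral of `|s - r| * exp (s * a)` over an interval containing `r`. -/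
theorem integral_abs_sub_mul_exp_mul {a : ℝ} (ha : a ≠ 0) {r x y : ℝ} (hx : x ≤ r) (hy : r ≤ y) :
    ∫ s in x..y, |s - r| * Real.exp (s * a) =
      ((x - r) / a - 1 / a ^ 2) * Real.exp (x * a) + 2 / a ^ 2 * Real.exp (r * a)
        + ((y - r) / a - 1 / a ^ 2) * Real.exp (y * a) := by
  have hint : ∀ u v : ℝ, IntervalIntegrable (fun s => |s - r| * Real.exp (s * a))
      MeasureTheory.volume u v :=
    fun u v => Continuous.intervalIntegrable (by fun_prop) _ _
  have hleft : ∫ s in x..r, |s - r| * Real.exp (s * a) =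
      -∫ s in x..r, (s - r) * Real.exp (s * a) := by
    rw [← intervalIntegral.integral_neg]
    refine intervalIntegral.integral_congr fun s hs => ?_
    rw [Set.uIcc_of_le hx] at hs
    simp only [abs_of_nonpos (sub_nonpos.2 hs.2), neg_mul]
  have hright : ∫ s in r..y, |s - r| * Real.exp (s * a) =
      ∫ s in r..y, (s - r) * Real.exp (s * a) := by
    refine intervalIntegral.integral_congr fun s hs => ?_
    rw [Set.uIcc_of_le hy] at hs
    simp only [abs_of_nonneg (sub_nonneg.2 hs.1)]
  rw [← intervalIntegral.integral_add_adjacent_intervals (hint x r) (hint r y), hleft, hright,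
    integral_sub_mul_exp_mul ha, integral_sub_mul_exp_mul ha]
  ring

/-- **Supersolution property.** For every `t ≥ 0`,
`1 + ∫₀ᵗ |s − max(0, t − √(log 2))| e^{s √(log 2)} ds ≤ e^{t √(log 2)}`, i.e. the pair
`v₂(t) = e^{t √(log 2)}`, `r₂(t) = max{0, t − √(log 2)}` is a supersolution of the
integral inequality `v(t) ≥ 1 + ∫₀ᵗ |s − r(t)| v(s) ds`. -/
theorem supersolution_exp_sqrt_log_two :
    ∀ t : ℝ, 0 ≤ t →
      1 + (∫ s in (0 : ℝ)..t,
          |s - max 0 (t - Real.sqrt (Real.log 2))| * Real.exp (s * Real.sqrt (Real.log 2)))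
        ≤ Real.exp (t * Real.sqrt (Real.log 2)) := by
  intro t ht
  have hlog : 0 < Real.log 2 := Real.log_pos one_lt_two
  have hlog_lt : Real.log 2 < 1 := Real.log_two_lt_d9.trans (by norm_num)
  set a := Real.sqrt (Real.log 2)
  have ha : 0 < a := Real.sqrt_pos.2 hlog
  have hsq : a ^ 2 = Real.log 2 := Real.sq_sqrt hlog.le
  rcases le_total t a with hta | hta
  · rw [max_eq_left (sub_nonpos.2 hta)]
    have hle : ∫ s in (0 : ℝ)..t, |s - 0| * Real.exp (s * a) ≤
        ∫ s in (0 : ℝ)..t, a * Real.exp (s * a) := by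
      refine intervalIntegral.integral_mono_on ht
        (Continuous.intervalIntegrable (by fun_prop) _ _)
        (Continuous.intervalIntegrable (by fun_prop) _ _) fun s hs => ?_
      rw [sub_zero, abs_of_nonneg hs.1]
      exact mul_le_mul_of_nonneg_right (hs.2.trans hta) (Real.exp_pos _).le
    have heq : ∫ s in (0 : ℝ)..t, a * Real.exp (s * a) = Real.exp (t * a) - 1 := by
      simp [intervalIntegral.integral_comp_mul_right (fun s => Real.exp s) ha.ne', ha.ne']
    linarith
  · have hr : 0 ≤ t - a := sub_nonneg.2 hta
    rw [max_eq_right hr, integral_abs_sub_mul_exp_mul ha.ne' hr (sub_le_self t ha.le)]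
    have hexp : Real.exp (t * a) = 2 * Real.exp ((t - a) * a) := by
      rw [show t * a = a ^ 2 + (t - a) * a by ring, Real.exp_add, hsq, Real.exp_log two_pos]
    have hinv : 1 ≤ 1 / a ^ 2 := by
      rw [hsq]
      exact one_le_one_div hlog hlog_lt.le
    have hdiv : 0 ≤ (t - a) / a := div_nonneg hr ha.le
    have hself : (t - (t - a)) / a = 1 := by
      rw [sub_sub_cancel, div_self ha.ne']
    rw [hself, hexp, zero_mul, Real.exp_zero, zero_sub, neg_div]
    linear_combination hinv + hdiv
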